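/- arXiv:1210.5587 — 4 statements merged into one kernel-verified Lean document; each statement's English description precedes it below -/
import Mathlib

section
/- Let A be the n×m incidence matrix (entries in {0,1}) of a bipartite graph H with n input vertices, each of degree k, and m output vertices, each of degree r = nk/m. Suppose λ₂ is a real number with λ₂ < kr such that vᵀ(AAᵀ)v ≤ λ₂‖v‖² for every vector v ∈ ℝⁿ whose coordinates sum to 0 (i.e., the second largest eigenvalue of AAᵀ is at most λ₂, the largest being kr with eigenvector the all-ones vector). Then for every α with 0 < α ≤ m/n and every set X of input vertices with |X| ≤ αn, the set Γ_X of outputs adjacent to some vertex of X satisfies |Γ_X| ≥ k²|X| / (α(kr − λ₂) + λ₂). -/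
open Finset Matrix

/-- The quadratic form of `A * Aᵀ` is the squared norm of `v ᵥ* A`. -/
theorem dotProduct_mul_transpose_mulVec {ι κ : Type*} [Fintype ι] [Fintype κ]
    (A : Matrix ι κ ℝ) (v : ι → ℝ) :
    v ⬝ᵥ (A * A.transpose).mulVec v = ∑ j, (∑ i, v i * A i j) ^ 2 := by
  rw [← Matrix.mulVec_mulVec, Matrix.dotProduct_mulVec, Matrix.mulVec_transpose]
  simp only [dotProduct, Matrix.vecMul, sq]

/-- **Tanner's eigenvalue bound for bounded strong concentrators.**
Let `A` be the `n × m` 0/1 incidence matrix of a bipartite graph whose `n` inputs all have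
degree `k` and whose `m` outputs all have degree `r`, where `n·k = m·r`.  If `λ₂ < kr`
bounds the quadratic form of `A * Aᵀ` on vectors with coordinate sum `0`, then for every
`0 < α ≤ m/n` and every set `X` of inputs with `|X| ≤ αn`, the set `Γ_X` of outputs adjacent
to some vertex of `X` satisfies `|Γ_X| ≥ k²|X| / (α(kr − λ₂) + λ₂)`. -/
theorem tanner_concentrator
    (n m k r : ℕ) (A : Matrix (Fin n) (Fin m) ℝ)
    (h01 : ∀ i j, A i j = 0 ∨ A i j = 1)
    (hrow : ∀ i, ∑ j, A i j = (k : ℝ))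
    (hcol : ∀ j, ∑ i, A i j = (r : ℝ))
    (hkr : n * k = m * r)
    (lam₂ : ℝ) (hlt : lam₂ < (k : ℝ) * r)
    (hquad : ∀ v : Fin n → ℝ, (∑ i, v i) = 0 →
      v ⬝ᵥ (A * A.transpose).mulVec v ≤ lam₂ * ∑ i, (v i) ^ 2) :
    ∀ α : ℝ, 0 < α → α ≤ (m : ℝ) / n →
      ∀ X : Finset (Fin n), (X.card : ℝ) ≤ α * n →
        (k : ℝ) ^ 2 * X.card / (α * ((k : ℝ) * r - lam₂) + lam₂) ≤
          ((Finset.univ.filter fun j : Fin m => ∃ i ∈ X, A i j = 1).card : ℝ) := by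
  intro α hα hαm X hX
  set d : Fin m → ℝ := fun j => ∑ i ∈ X, A i j with hd
  set G : Finset (Fin m) := Finset.univ.filter fun j : Fin m => ∃ i ∈ X, A i j = 1 with hG
  set x : ℝ := (X.card : ℝ) with hx
  have hx0 : 0 ≤ x := Nat.cast_nonneg _
  rcases hx0.eq_or_lt with h0 | hxpos
  · rw [← h0]
    simp
  have hnpos : 0 < (n : ℝ) := pos_of_mul_pos_right (hxpos.trans_le hX) hα.le
  have hn : (n : ℝ) ≠ 0 := hnpos.ne'
  have hkr' : (n : ℝ) * k = m * r := by exact_mod_cast hkr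
  have hsumd : ∑ j, d j = k * x := by
    rw [hd, Finset.sum_comm]
    simp [hrow, hx, mul_comm]
  have hd0 : ∀ j, j ∉ G → d j = 0 := by
    intro j hj
    refine Finset.sum_eq_zero fun i hi => (h01 i j).resolve_right fun h => hj ?_
    simpa [hG] using ⟨i, hi, h⟩
  have hq := hquad (fun i => (if i ∈ X then 1 else 0) - x / n) (by
    simp [Finset.sum_sub_distrib, ← hx]
    field_simp
    ring)
  rw [dotProduct_mul_transpose_mulVec] at hq
  have hnorm : ∑ i : Fin n, ((if i ∈ X then (1 : ℝ) else 0) - x / n) ^ 2 = x - x ^ 2 / n := by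
    have h : ∀ i : Fin n, ((if i ∈ X then (1 : ℝ) else 0) - x / n) ^ 2 =
        (if i ∈ X then 1 - 2 * (x / n) else 0) + (x / n) ^ 2 := by
      intro i
      split_ifs <;> ring
    simp only [h, Finset.sum_add_distrib, Finset.sum_ite_mem, Finset.univ_inter,
      Finset.sum_const, Finset.card_univ, Fintype.card_fin, nsmul_eq_mul, ← hx]
    field_simp
    ring
  have hcoord : ∀ j, ∑ i, ((if i ∈ X then (1 : ℝ) else 0) - x / n) * A i j =
      d j - r * (x / n) := by
    intro j
    simp [sub_mul, Finset.sum_sub_distrib, ← Finset.mul_sum, hcol, hd, mul_comm (r : ℝ)]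
  have hform : ∑ j, (d j - r * (x / n)) ^ 2 = ∑ j, d j ^ 2 - k * r * x ^ 2 / n := by
    have h : ∀ j, (d j - r * (x / n)) ^ 2 =
        d j ^ 2 - 2 * (r * (x / n)) * d j + (r * (x / n)) ^ 2 := fun j => by ring
    simp only [h, Finset.sum_add_distrib, Finset.sum_sub_distrib, ← Finset.mul_sum, hsumd,
      Finset.sum_const, Finset.card_univ, Fintype.card_fin, nsmul_eq_mul]
    field_simp
    linear_combination (-(x ^ 2) * r) * hkr'
  simp only [hcoord] at hq
  rw [hform, hnorm] at hq
  have hcs : (k * x) ^ 2 ≤ (G.card : ℝ) * ∑ j, d j ^ 2 := by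
    rw [← hsumd, ← Finset.sum_subset (Finset.subset_univ G) fun j _ hj => hd0 j hj]
    refine sq_sum_le_card_mul_sum_sq.trans ?_
    gcongr
    exact Finset.subset_univ G
  have hG0 : 0 ≤ (G.card : ℝ) := Nat.cast_nonneg _
  have hxn : x / n ≤ α := (div_le_iff₀ hnpos).2 hX
  have hbound : ∑ j, d j ^ 2 ≤ x * (α * (k * r - lam₂) + lam₂) := by
    have h1 : x / n * (k * r - lam₂) ≤ α * (k * r - lam₂) :=
      mul_le_mul_of_nonneg_right hxn (sub_nonneg.2 hlt.le)
    have h2 := mul_le_mul_of_nonneg_left h1 hx0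
    have h3 : x * (x / n * (k * r - lam₂)) =
        k * r * x ^ 2 / n - lam₂ * (x ^ 2 / n) := by ring
    linarith
  have hmain : (k : ℝ) ^ 2 * x ≤ G.card * (α * (k * r - lam₂) + lam₂) := by
    refine le_of_mul_le_mul_left ?_ hxpos
    linarith [mul_le_mul_of_nonneg_left hbound hG0]
  rcases le_or_gt (α * ((k : ℝ) * r - lam₂) + lam₂) 0 with hD | hD
  · exact (div_nonpos_of_nonneg_of_nonpos (by positivity) hD).trans hG0
  · exact (div_le_iff₀ hD).2 hmain
end

section
/- Let A be the incidence matrix of a (v,b,r,k,λ)-BIBD with r > λ ≥ 1 and r(k−1) = λ(v−1). Then the associated bipartite graph (with the v objects as inputs, each of degree r, and the b blocks as outputs, each of degree k) is a bounded strong concentrator in the following quantitative sense: for every α with 0 < α ≤ b/v and every set X of objects with |X| ≤ αv, the set Γ_X of blocks containing at least one object of X satisfies |Γ_X| ≥ r²|X| / (α(rk − (r−λ)) + (r−λ)). -/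
open Finset

/-- Cauchy–Schwarz for the neighbourhood of `X`: the squared number of edges leaving `X` is at most
`|Γ_X|` times the sum of the squared degrees of the outputs into `X`. -/
theorem sq_sum_le_card_neighbors_mul {ι κ : Type*} [Fintype κ] (A : ι → κ → ℝ)
    (h01 : ∀ i j, A i j = 0 ∨ A i j = 1) (X : Finset ι)
    [DecidablePred fun j => ∃ i ∈ X, A i j = 1] :
    (∑ i ∈ X, ∑ j, A i j) ^ 2 ≤
      ((univ.filter fun j => ∃ i ∈ X, A i j = 1).card : ℝ) * ∑ j, (∑ i ∈ X, A i j) ^ 2 := by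
  have hsupp : ∑ j ∈ univ.filter (fun j => ∃ i ∈ X, A i j = 1), ∑ i ∈ X, A i j
      = ∑ j, ∑ i ∈ X, A i j := by
    refine sum_subset (subset_univ _) fun j _ hj => sum_eq_zero fun i hi => ?_
    exact (h01 i j).resolve_right fun h => hj (mem_filter.2 ⟨mem_univ _, i, hi, h⟩)
  rw [sum_comm, ← hsupp]
  refine sq_sum_le_card_mul_sum_sq.trans ?_
  gcongr
  exact subset_univ _

/-- If all diagonal inner products of rows equal `r` and all others equal `l`, the squared column
sums over `X` add up to `|X| (l |X| + (r - l))`. -/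
theorem sum_sq_column_sums {ι κ : Type*} [Fintype κ] (A : ι → κ → ℝ) {r l : ℝ}
    (hdiag : ∀ i, ∑ j, A i j * A i j = r)
    (hinner : ∀ i i', i ≠ i' → ∑ j, A i j * A i' j = l) (X : Finset ι) :
    ∑ j, (∑ i ∈ X, A i j) ^ 2 = X.card * (l * X.card + (r - l)) := by
  classical
  have hprod : ∀ i i', ∑ j, A i j * A i' j = l + if i = i' then r - l else 0 := by
    intro i i'
    by_cases h : i = i'
    · subst h
      simp [hdiag]
    · simp [h, hinner i i' h]
  calc ∑ j, (∑ i ∈ X, A i j) ^ 2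
      = ∑ i ∈ X, ∑ i' ∈ X, ∑ j, A i j * A i' j := by
        simp_rw [sq, sum_mul_sum]
        rw [sum_comm]
        exact sum_congr rfl fun i _ => sum_comm
    _ = ∑ i ∈ X, (l * X.card + (r - l)) := by
        refine sum_congr rfl fun i hi => ?_
        simp [hprod, sum_add_distrib, hi, mul_comm]
    _ = X.card * (l * X.card + (r - l)) := by simp [mul_add]

/-- The incidence bipartite graph of a `(v,b,r,k,λ)`-BIBD (objects as
inputs of degree `r`, blocks as outputs of degree `k`, `r > λ ≥ 1`, `r(k−1) = λ(v−1)`) is a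
bounded strong concentrator: for every `0 < α ≤ b/v` and every set `X` of objects with
`|X| ≤ αv`, the set `Γ_X` of blocks containing at least one object of `X` satisfies
`|Γ_X| ≥ r²|X| / (α(rk − (r−λ)) + (r−λ))`. -/
theorem bibd_is_bounded_strong_concentrator
    (v b r k lam : ℕ) (hlam : 1 ≤ lam) (hrl : lam < r)
    (hfisher : r * (k - 1) = lam * (v - 1))
    (A : Matrix (Fin v) (Fin b) ℝ)
    (h01 : ∀ i j, A i j = 0 ∨ A i j = 1)
    (hrow : ∀ i, ∑ j, A i j = (r : ℝ))
    (hcol : ∀ j, ∑ i, A i j = (k : ℝ))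
    (hinner : ∀ i i' : Fin v, i ≠ i' → ∑ j, A i j * A i' j = (lam : ℝ)) :
    ∀ α : ℝ, 0 < α → α ≤ (b : ℝ) / v →
      ∀ X : Finset (Fin v), (X.card : ℝ) ≤ α * v →
        (r : ℝ) ^ 2 * X.card /
            (α * ((r : ℝ) * k - ((r : ℝ) - lam)) + ((r : ℝ) - lam)) ≤
          ((Finset.univ.filter fun j : Fin b => ∃ i ∈ X, A i j = 1).card : ℝ) := by
  intro α hα _ X hX
  rcases X.eq_empty_or_nonempty with rfl | hne
  · simp
  have hx : (0 : ℝ) < X.card := by exact_mod_cast hne.card_pos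
  obtain ⟨i₀, -⟩ := hne
  have hv : 1 ≤ v := i₀.pos
  have hl : (1 : ℝ) ≤ lam := by exact_mod_cast hlam
  have hr : (lam : ℝ) < r := by exact_mod_cast hrl
  have hk : 1 ≤ k := by
    by_contra! hk
    have hzero : ∀ j, A i₀ j = 0 := fun j => by
      have hsum : ∑ i, A i j = 0 := by
        rw [hcol j, Nat.lt_one_iff.1 hk, Nat.cast_zero]
      refine (sum_eq_zero_iff_of_nonneg fun i _ => ?_).1 hsum i₀ (mem_univ _)
      rcases h01 i j with h | h <;> simp [h]
    have hrow₀ := hrow i₀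
    simp only [hzero, sum_const_zero] at hrow₀
    linarith
  have hparam : (r : ℝ) * k - (r - lam) = lam * v := by
    have h := congrArg (Nat.cast : ℕ → ℝ) hfisher
    push_cast [Nat.cast_sub hk, Nat.cast_sub hv] at h
    linarith
  have hdiag : ∀ i, ∑ j, A i j * A i j = (r : ℝ) := fun i => by
    rw [← hrow i]
    exact sum_congr rfl fun j _ => by rcases h01 i j with h | h <;> simp [h]
  have hcs := sq_sum_le_card_neighbors_mul A h01 X
  rw [sum_sq_column_sums A hdiag hinner X] at hcs
  simp only [hrow, sum_const, nsmul_eq_mul] at hcs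
  set g : ℝ := ((univ.filter fun j : Fin b => ∃ i ∈ X, A i j = 1).card : ℝ)
  have hmain : (r : ℝ) ^ 2 * X.card ≤ g * (lam * X.card + (r - lam)) :=
    le_of_mul_le_mul_left (by linarith) hx
  have hden : (lam : ℝ) * X.card ≤ α * (lam * v) := by nlinarith
  rw [hparam, div_le_iff₀ (by nlinarith)]
  refine hmain.trans ?_
  gcongr
end

section
/- Let X be a d-regular graph on n vertices with adjacency matrix A_X which is an (n,d,ε)-magnifier, and let Q = d·I − A_X be its Laplacian matrix. Then the second smallest eigenvalue λ(X) of Q satisfies λ(X) ≥ ε²/(4 + 2ε²); equivalently, vᵀQv ≥ (ε²/(4 + 2ε²))·‖v‖² for every vector v ∈ ℝⁿ whose coordinates sum to 0. -/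
open Finset Matrix

/-- The sum of squares of numbers in `[0, 1]` with total `1 + r` is at most `1 + r ^ 2`. -/
lemma sum_sq_le_one_add_sq {V : Type*} [Fintype V] (a : V → ℝ) (r : ℝ)
    (h0 : ∀ v, 0 ≤ a v) (h1 : ∀ v, a v ≤ 1) (hs : ∑ v, a v = 1 + r) :
    ∑ v, a v ^ 2 ≤ 1 + r ^ 2 := by
  classical
  rcases le_or_gt 1 r with hr | hr
  · calc ∑ v, a v ^ 2 ≤ ∑ v, a v := sum_le_sum fun v _ => by nlinarith [h0 v, h1 v]
      _ ≤ 1 + r ^ 2 := by nlinarith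
  by_cases hall : ∀ v, a v ≤ r
  · calc ∑ v, a v ^ 2 ≤ ∑ v, r * a v := sum_le_sum fun v _ => by nlinarith [h0 v, hall v]
      _ = r * (1 + r) := by rw [← mul_sum, hs]
      _ ≤ 1 + r ^ 2 := by nlinarith
  · push Not at hall
    obtain ⟨w, hw⟩ := hall
    have e1 := add_sum_erase univ a (mem_univ w)
    have e2 := add_sum_erase univ (fun v => a v ^ 2) (mem_univ w)
    have hle : ∑ v ∈ univ.erase w, a v ^ 2 ≤ (∑ v ∈ univ.erase w, a v) ^ 2 :=
      sum_sq_le_sq_sum_of_nonneg fun v _ => h0 v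
    have e3 : ∑ v ∈ univ.erase w, a v = 1 + r - a w := by linarith
    rw [e3] at hle
    nlinarith [mul_nonneg (sub_nonneg.2 (h1 w)) (sub_nonneg.2 hw.le)]

/-- A fractional form of Hall's marriage theorem: if every `S ⊆ s` has at least `(p / q) * #S`
neighbours, then every element of `s` can distribute weight `p / q` among its neighbours so that
nobody receives more than `1`. -/
lemma exists_fractional_matching {V : Type*} [Fintype V] [DecidableEq V] (s : Finset V)
    (t : V → Finset V) (p q : ℕ) (hq : 0 < q)
    (hall : ∀ S ⊆ s, p * #S ≤ q * #(S.biUnion t)) :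
    ∃ h : V → V → ℝ, (∀ u v, 0 ≤ h u v) ∧ (∀ u v, v ∉ t u → h u v = 0) ∧
      (∀ u ∈ s, ∑ v, h u v = p / q) ∧ ∀ v, ∑ u, h u v ≤ 1 := by
  have hall' : ∀ S : Finset ({u // u ∈ s} × Fin p),
      #S ≤ #(S.biUnion fun y => t y.1 ×ˢ (univ : Finset (Fin q))) := by
    intro S
    let T : Finset V := S.image fun y => (y.1 : V)
    have hT : T ⊆ s := by
      intro u hu
      obtain ⟨y, -, rfl⟩ := mem_image.1 hu
      exact y.1.2
    have hST : #S ≤ #(T ×ˢ (univ : Finset (Fin p))) := by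
      refine card_le_card_of_injOn (fun y => ((y.1 : V), y.2)) ?_ ?_
      · intro y hy
        simp only [coe_product, Set.mem_prod, mem_coe, mem_univ, and_true]
        exact mem_image_of_mem _ hy
      · rintro ⟨⟨a, ha⟩, i⟩ _ ⟨⟨b, hb⟩, j⟩ _ hab
        simpa using hab
    have hBU : S.biUnion (fun y => t y.1 ×ˢ (univ : Finset (Fin q)))
        = T.biUnion t ×ˢ (univ : Finset (Fin q)) := by
      ext ⟨v, j⟩
      simp [T]
    rw [hBU, card_product, card_univ, Fintype.card_fin, mul_comm]
    rw [card_product, card_univ, Fintype.card_fin, mul_comm] at hST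
    exact hST.trans (hall T hT)
  obtain ⟨f, hf, hft⟩ := (all_card_le_biUnion_card_iff_exists_injective _).1 hall'
  have hq' : (0 : ℝ) < q := by exact_mod_cast hq
  refine ⟨fun u v => (#{y | (y.1 : V) = u ∧ (f y).1 = v} : ℝ) / q,
    fun u v => by positivity, ?_, ?_, ?_⟩
  · intro u v huv
    have : ({y | (y.1 : V) = u ∧ (f y).1 = v} : Finset ({u // u ∈ s} × Fin p)) = ∅ := by
      refine filter_eq_empty_iff.2 ?_
      rintro y - ⟨rfl, rfl⟩
      exact huv (mem_product.1 (hft y)).1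
    simp [this]
  · intro u hu
    rw [← sum_div, ← Nat.cast_sum]
    congr 2
    have h1 := card_eq_sum_card_fiberwise
      (s := ({y | (y.1 : V) = u} : Finset ({u // u ∈ s} × Fin p))) (t := univ)
      (f := fun y => (f y).1) (fun _ _ => by simp)
    simp only [filter_filter] at h1
    rw [← h1]
    have h2 : ({y | (y.1 : V) = u} : Finset ({u // u ∈ s} × Fin p))
        = {(⟨u, hu⟩ : {u // u ∈ s})} ×ˢ (univ : Finset (Fin p)) := by
      ext ⟨⟨a, ha⟩, i⟩
      simp [eq_comm]
    rw [h2, card_product]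
    simp
  · intro v
    rw [← sum_div, ← Nat.cast_sum, div_le_one hq']
    have h1 := card_eq_sum_card_fiberwise
      (s := ({y | (f y).1 = v} : Finset ({u // u ∈ s} × Fin p))) (t := univ)
      (f := fun y => (y.1 : V)) (fun _ _ => by simp)
    simp only [filter_filter] at h1
    simp_rw [and_comm (b := (f _).1 = v)]
    rw [← h1]
    have h2 : #({y | (f y).1 = v} : Finset ({u // u ∈ s} × Fin p))
        ≤ #({v} ×ˢ (univ : Finset (Fin q))) := by
      refine card_le_card_of_injOn f ?_ hf.injOn
      intro y hy
      exact mem_product.2 ⟨mem_singleton.2 (mem_filter.1 hy).2, mem_univ _⟩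
    simpa using h2

/-- The weights of a fractional matching along the edges of `G`, in which every vertex of the
support of `g` sends out `1 + r` and every vertex receives at most `1`, bound the Dirichlet form
of `g` from below. -/
lemma sq_mul_sum_sq_le_of_flow {V : Type*} [Fintype V] [DecidableEq V]
    (G : SimpleGraph V) [DecidableRel G.Adj] (g : V → ℝ) (r : ℝ) (hr : 0 ≤ r) (h : V → V → ℝ)
    (h0 : ∀ u v, 0 ≤ h u v) (hadj : ∀ u v, u ≠ v → ¬ G.Adj u v → h u v = 0)
    (hout : ∀ u, g u ≠ 0 → ∑ v, h u v = 1 + r) (hin : ∀ v, ∑ u, h u v ≤ 1) :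
    r ^ 2 * ∑ u, g u ^ 2 ≤
      (4 + 2 * r ^ 2) * ((∑ u, ∑ v, if G.Adj u v then (g u - g v) ^ 2 else 0) / 2) := by
  set S := ∑ u, g u ^ 2 with hS
  set D := ∑ u, ∑ v, if G.Adj u v then (g u - g v) ^ 2 else 0 with hD
  have hle1 : ∀ u v, h u v ≤ 1 := fun u v =>
    (single_le_sum (f := fun u => h u v) (fun u _ => h0 u v) (mem_univ u)).trans (hin v)
  have hS0 : 0 ≤ S := sum_nonneg fun u _ => sq_nonneg _
  have hD0 : 0 ≤ D := sum_nonneg fun u _ => sum_nonneg fun v _ => by split_ifs <;> positivity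
  have hflow : r * S ≤ ∑ u, ∑ v, h u v * (g u ^ 2 - g v ^ 2) := by
    have e1 : ∑ u, ∑ v, h u v * g u ^ 2 = (1 + r) * S := by
      rw [hS, mul_sum]
      refine sum_congr rfl fun u _ => ?_
      rw [← sum_mul]
      by_cases hu : g u = 0
      · simp [hu]
      · rw [hout u hu]
    have e2 : ∑ u, ∑ v, h u v * g v ^ 2 ≤ S := by
      rw [sum_comm, hS]
      refine sum_le_sum fun v _ => ?_
      rw [← sum_mul]
      exact mul_le_of_le_one_left (sq_nonneg _) (hin v)
    simp only [mul_sub, sum_sub_distrib]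
    linarith
  have hanti : ∑ u, ∑ v, (h u v - h v u) * (g u ^ 2 - g v ^ 2)
      = 2 * ∑ u, ∑ v, h u v * (g u ^ 2 - g v ^ 2) := by
    have e : ∑ u, ∑ v, h v u * (g u ^ 2 - g v ^ 2)
        = - ∑ u, ∑ v, h u v * (g u ^ 2 - g v ^ 2) := by
      rw [sum_comm]
      simp only [← sum_neg_distrib]
      exact sum_congr rfl fun u _ => sum_congr rfl fun v _ => by ring
    simp only [sub_mul, sum_sub_distrib]
    linarith
  have hcs : (∑ u, ∑ v, (h u v - h v u) * (g u ^ 2 - g v ^ 2)) ^ 2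
      ≤ (∑ u, ∑ v, (h u v - h v u) ^ 2 * (g u + g v) ^ 2) * D := by
    have := sum_mul_sq_le_sq_mul_sq (univ : Finset (V × V))
      (fun y => (h y.1 y.2 - h y.2 y.1) * (g y.1 + g y.2))
      (fun y => if G.Adj y.1 y.2 then g y.1 - g y.2 else 0)
    simp only [Fintype.sum_prod_type, mul_pow] at this
    have eL : ∑ u, ∑ v, (h u v - h v u) * (g u + g v) * (if G.Adj u v then g u - g v else 0)
        = ∑ u, ∑ v, (h u v - h v u) * (g u ^ 2 - g v ^ 2) := by
      refine sum_congr rfl fun u _ => sum_congr rfl fun v _ => ?_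
      by_cases huv : u = v
      · simp [huv]
      by_cases ha : G.Adj u v
      · simp only [ha, if_true]; ring
      · simp [ha, hadj u v huv ha, hadj v u (Ne.symm huv) (fun h => ha h.symm)]
    have eR : ∑ u, ∑ v, (if G.Adj u v then g u - g v else 0) ^ 2 = D := by
      refine sum_congr rfl fun u _ => sum_congr rfl fun v _ => ?_
      split_ifs <;> simp
    rwa [eL, eR] at this
  have hK : ∑ u, ∑ v, (h u v - h v u) ^ 2 * (g u + g v) ^ 2 ≤ 4 * (2 + r ^ 2) * S := by
    have e1 : ∑ u, ∑ v, (h u v - h v u) ^ 2 * (g u + g v) ^ 2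
        ≤ ∑ u, ∑ v, (2 * (h u v ^ 2 * (g u ^ 2 + g v ^ 2))
          + 2 * (h v u ^ 2 * (g u ^ 2 + g v ^ 2))) := by
      refine sum_le_sum fun u _ => sum_le_sum fun v _ => ?_
      have a1 : (h u v - h v u) ^ 2 ≤ h u v ^ 2 + h v u ^ 2 := by
        nlinarith [mul_nonneg (h0 u v) (h0 v u)]
      have a2 : (g u + g v) ^ 2 ≤ 2 * (g u ^ 2 + g v ^ 2) := add_sq_le
      calc _ ≤ (h u v ^ 2 + h v u ^ 2) * (2 * (g u ^ 2 + g v ^ 2)) := by gcongr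
        _ = _ := by ring
    have e2 : ∑ u, ∑ v, h v u ^ 2 * (g u ^ 2 + g v ^ 2)
        = ∑ u, ∑ v, h u v ^ 2 * (g u ^ 2 + g v ^ 2) := by
      rw [sum_comm]
      exact sum_congr rfl fun u _ => sum_congr rfl fun v _ => by ring
    have e3 : ∑ u, ∑ v, h u v ^ 2 * g u ^ 2 ≤ (1 + r ^ 2) * S := by
      rw [hS, mul_sum]
      refine sum_le_sum fun u _ => ?_
      rw [← sum_mul]
      by_cases hu : g u = 0
      · simp [hu]
      · exact mul_le_mul_of_nonneg_right
          (sum_sq_le_one_add_sq _ r (h0 u) (hle1 u) (hout u hu)) (sq_nonneg _)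
    have e4 : ∑ u, ∑ v, h u v ^ 2 * g v ^ 2 ≤ S := by
      rw [sum_comm, hS]
      refine sum_le_sum fun v _ => ?_
      rw [← sum_mul]
      refine mul_le_of_le_one_left (sq_nonneg _) (le_trans ?_ (hin v))
      exact sum_le_sum fun u _ => by nlinarith [h0 u v, hle1 u v]
    simp only [sum_add_distrib, ← mul_sum] at e1
    rw [e2] at e1
    simp only [mul_add, sum_add_distrib] at e1
    linarith
  have hmain : (2 * (r * S)) ^ 2 ≤ 4 * (2 + r ^ 2) * S * D := by
    refine le_trans ?_ (hcs.trans (mul_le_mul_of_nonneg_right hK hD0))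
    rw [hanti]
    gcongr
  rcases hS0.eq_or_lt with hz | hpos
  · rw [← hz, mul_zero]
    positivity
  · refine le_of_mul_le_mul_right ?_ hpos
    nlinarith

/-- In a magnifier, the Dirichlet form of a function supported on at most half of the vertices
is bounded below by a multiple of its squared norm. -/
lemma dirichlet_lower_bound_of_card_support_le {V : Type*} [Fintype V] [DecidableEq V]
    (G : SimpleGraph V) [DecidableRel G.Adj] (ε : ℝ) (hε : 0 < ε)
    (hmag : ∀ X : Finset V, (#X : ℝ) ≤ Fintype.card V / 2 →
      ε * #X ≤ (#{w | w ∉ X ∧ ∃ u ∈ X, G.Adj u w} : ℝ))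
    (g : V → ℝ) (hg : (#{v | g v ≠ 0} : ℝ) ≤ Fintype.card V / 2) :
    (ε ^ 2 / (4 + 2 * ε ^ 2)) * ∑ u, g u ^ 2 ≤
      (∑ u, ∑ v, if G.Adj u v then (g u - g v) ^ 2 else 0) / 2 := by
  set S := ∑ u, g u ^ 2 with hS
  set E := (∑ u, ∑ v, if G.Adj u v then (g u - g v) ^ 2 else 0) / 2 with hE
  have hE0 : 0 ≤ E := div_nonneg
    (sum_nonneg fun u _ => sum_nonneg fun v _ => by split_ifs <;> positivity) zero_le_two
  have key : ∀ r : ℚ, 0 ≤ r → (r : ℝ) < ε → (r : ℝ) ^ 2 * S ≤ (4 + 2 * (r : ℝ) ^ 2) * E := by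
    intro r hr hrε
    have hq : (0 : ℝ) < r.den := by exact_mod_cast r.den_pos
    have hrr : (r : ℝ) = r.num.toNat / r.den := by
      have h1 : ((r.num.toNat : ℤ) : ℝ) = r.num := by
        rw [Int.toNat_of_nonneg (Rat.num_nonneg.2 hr)]
      rw [← Int.cast_natCast, h1]
      exact Rat.cast_def r
    obtain ⟨h, h0, ht, hout, hin⟩ := exists_fractional_matching {v | g v ≠ 0}
      (fun u => insert u (G.neighborFinset u)) (r.den + r.num.toNat) r.den r.den_pos (by
        intro X hX
        have hXc : (#X : ℝ) ≤ Fintype.card V / 2 :=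
          le_trans (by exact_mod_cast card_le_card hX) hg
        have hm := hmag X hXc
        have hun : X.biUnion (fun u => insert u (G.neighborFinset u))
            = X ∪ ({w | w ∉ X ∧ ∃ u ∈ X, G.Adj u w} : Finset V) := by
          ext w
          simp only [mem_biUnion, mem_insert, SimpleGraph.mem_neighborFinset, mem_union,
            mem_filter, mem_univ, true_and]
          constructor
          · rintro ⟨u, hu, rfl | hw⟩
            · exact Or.inl hu
            · by_cases hwX : w ∈ X
              · exact Or.inl hwX
              · exact Or.inr ⟨hwX, u, hu, hw⟩
          · rintro (hw | ⟨-, u, hu, hw⟩)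
            · exact ⟨w, hw, Or.inl rfl⟩
            · exact ⟨u, hu, Or.inr hw⟩
        have hdis : Disjoint X ({w | w ∉ X ∧ ∃ u ∈ X, G.Adj u w} : Finset V) := by
          rw [disjoint_left]
          intro w hw hw'
          exact (mem_filter.1 hw').2.1 hw
        rw [hun, card_union_of_disjoint hdis]
        have hnum : (r.num.toNat : ℝ) ≤ r.den * ε := by
          rw [hrr, div_lt_iff₀ hq] at hrε
          linarith
        have h2 : (r.num.toNat : ℝ) * #X ≤ r.den * (ε * #X) := by
          rw [← mul_assoc]
          gcongr
        have h3 := h2.trans (mul_le_mul_of_nonneg_left hm hq.le)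
        rw [add_mul, mul_add]
        exact Nat.add_le_add_left (by exact_mod_cast h3) _)
    refine sq_mul_sum_sq_le_of_flow G g r (by exact_mod_cast hr) h h0 ?_ ?_ hin
    · intro u v huv ha
      refine ht u v ?_
      simp [ha, Ne.symm huv]
    · intro u hu
      rw [hout u (by simpa using hu), hrr]
      push_cast
      field_simp
  rw [div_mul_eq_mul_div, div_le_iff₀ (by positivity)]
  by_contra! hcon
  have hpos : 0 < S - 2 * E := by
    by_contra! hneg
    nlinarith [mul_nonneg (sq_nonneg ε) (sub_nonneg.2 hneg)]
  have hlt : √(4 * E / (S - 2 * E)) < ε := by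
    rw [Real.sqrt_lt' hε, div_lt_iff₀ hpos]
    linarith
  obtain ⟨r, hr1, hr2⟩ := exists_rat_btwn hlt
  have hr0 : (0 : ℝ) < r := (Real.sqrt_nonneg _).trans_lt hr1
  have := key r (by exact_mod_cast hr0.le) hr2
  rw [Real.sqrt_lt' hr0, div_lt_iff₀ hpos] at hr1
  linarith

/-- Every real function on a nonempty finite type has a median. -/
lemma exists_median {V : Type*} [Fintype V] [Nonempty V] (x : V → ℝ) :
    ∃ m : ℝ, 2 * #{v | m < x v} ≤ Fintype.card V ∧ 2 * #{v | x v < m} ≤ Fintype.card V := by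
  classical
  obtain ⟨i₀, -, hi₀⟩ := exists_max_image (univ : Finset V) x univ_nonempty
  let T : Finset V := {i | 2 * #{v | x i < x v} ≤ Fintype.card V}
  have hT : T.Nonempty := by
    refine ⟨i₀, mem_filter.2 ⟨mem_univ _, ?_⟩⟩
    rw [filter_eq_empty_iff.2 fun v hv => not_lt.2 (hi₀ v hv)]
    simp
  obtain ⟨i, hiT, hi⟩ := exists_min_image T x hT
  refine ⟨x i, (mem_filter.1 hiT).2, ?_⟩
  by_contra! hcon
  have hne : ({v | x v < x i} : Finset V).Nonempty := by
    rw [← card_pos]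
    omega
  obtain ⟨k, hk, hkmax⟩ := exists_max_image _ x hne
  have hki : x k < x i := (mem_filter.1 hk).2
  have hsub : #{v | x k < x v} ≤ #{v | ¬ x v < x i} := by
    refine card_le_card fun v hv => ?_
    simp only [mem_filter, mem_univ, true_and] at hv ⊢
    intro hvi
    exact absurd (hkmax v (by simpa using hvi)) (not_le.2 hv)
  have hadd := card_filter_add_card_filter_not (s := (univ : Finset V)) (fun v => x v < x i)
  rw [card_univ] at hadd
  have hkT : k ∈ T := mem_filter.2 ⟨mem_univ _, by omega⟩
  exact absurd (hi k hkT) (not_le.2 hki)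

/-- Taking positive and negative parts does not increase the total squared difference. -/
lemma max_sub_max_sq_add_le (a b : ℝ) :
    (max a 0 - max b 0) ^ 2 + (max (-a) 0 - max (-b) 0) ^ 2 ≤ (a - b) ^ 2 := by
  rcases le_total a 0 with ha | ha <;> rcases le_total b 0 with hb | hb <;>
    simp only [max_eq_left, max_eq_right, ha, hb, neg_nonneg, neg_nonpos] <;>
    nlinarith

/-- In a magnifier, the Dirichlet form of a function with zero sum is bounded below by a multiple
of its squared norm. -/
lemma dirichlet_lower_bound_of_sum_eq_zero {V : Type*} [Fintype V] [DecidableEq V]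
    (G : SimpleGraph V) [DecidableRel G.Adj] (ε : ℝ) (hε : 0 < ε)
    (hmag : ∀ X : Finset V, (#X : ℝ) ≤ Fintype.card V / 2 →
      ε * #X ≤ (#{w | w ∉ X ∧ ∃ u ∈ X, G.Adj u w} : ℝ))
    (x : V → ℝ) (hx : ∑ v, x v = 0) :
    (ε ^ 2 / (4 + 2 * ε ^ 2)) * ∑ u, x u ^ 2 ≤
      (∑ u, ∑ v, if G.Adj u v then (x u - x v) ^ 2 else 0) / 2 := by
  rcases isEmpty_or_nonempty V with hV | hV
  · simp
  obtain ⟨m, hm1, hm2⟩ := exists_median x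
  have hP := dirichlet_lower_bound_of_card_support_le G ε hε hmag (fun v => max (x v - m) 0) (by
    rw [le_div_iff₀ two_pos, mul_comm]
    simpa using (by exact_mod_cast hm1 : (2 : ℝ) * #{v | m < x v} ≤ Fintype.card V))
  have hN := dirichlet_lower_bound_of_card_support_le G ε hε hmag (fun v => max (m - x v) 0) (by
    rw [le_div_iff₀ two_pos, mul_comm]
    simpa using (by exact_mod_cast hm2 : (2 : ℝ) * #{v | x v < m} ≤ Fintype.card V))
  have hnorm : ∑ v, x v ^ 2 ≤ ∑ v, max (x v - m) 0 ^ 2 + ∑ v, max (m - x v) 0 ^ 2 := by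
    have e1 : ∑ v, max (x v - m) 0 ^ 2 + ∑ v, max (m - x v) 0 ^ 2
        = ∑ v, (x v ^ 2 - 2 * m * x v + m ^ 2) := by
      rw [← sum_add_distrib]
      refine sum_congr rfl fun v _ => ?_
      rcases le_total (x v) m with hv | hv
      · rw [max_eq_right (by linarith), max_eq_left (by linarith)]; ring
      · rw [max_eq_left (by linarith), max_eq_right (by linarith)]; ring
    rw [e1, sum_add_distrib, sum_sub_distrib, ← mul_sum, hx, mul_zero, sub_zero]
    exact le_add_of_nonneg_right (sum_nonneg fun _ _ => sq_nonneg m)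
  have hsplit : (∑ u, ∑ v, if G.Adj u v then (max (x u - m) 0 - max (x v - m) 0) ^ 2 else 0)
      + (∑ u, ∑ v, if G.Adj u v then (max (m - x u) 0 - max (m - x v) 0) ^ 2 else 0)
      ≤ ∑ u, ∑ v, if G.Adj u v then (x u - x v) ^ 2 else 0 := by
    simp only [← sum_add_distrib]
    refine sum_le_sum fun u _ => sum_le_sum fun v _ => ?_
    split_ifs
    · have := max_sub_max_sq_add_le (x u - m) (x v - m)
      simpa only [neg_sub, sub_sub_sub_cancel_right] using this
    · simp
  have hc := mul_le_mul_of_nonneg_left hnorm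
    (by positivity : 0 ≤ ε ^ 2 / (4 + 2 * ε ^ 2))
  rw [mul_add] at hc
  linarith

/-- **Alon.**  If a `d`-regular graph `X` on `n` vertices is an
`(n,d,ε)`-magnifier, then the second smallest eigenvalue of its Laplacian
`Q = d·I − A_X` is at least `ε²/(4 + 2ε²)`; equivalently
`xᵀQx ≥ (ε²/(4+2ε²))·‖x‖²` for every vector `x` with coordinate sum `0`. -/
theorem magnifier_laplacian_eigenvalue_bound
    (n d : ℕ) (ε : ℝ) (hε : 0 < ε)
    (G : SimpleGraph (Fin n)) [DecidableRel G.Adj]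
    (hreg : ∀ v : Fin n, G.degree v = d)
    (hmag : ∀ X : Finset (Fin n), (X.card : ℝ) ≤ n / 2 →
      ε * X.card ≤
        ((Finset.univ.filter fun w => w ∉ X ∧ ∃ u ∈ X, G.Adj u w).card : ℝ)) :
    ∀ x : Fin n → ℝ, (∑ i, x i) = 0 →
      (ε ^ 2 / (4 + 2 * ε ^ 2)) * ∑ i, (x i) ^ 2 ≤
        x ⬝ᵥ ((d : ℝ) • (1 : Matrix (Fin n) (Fin n) ℝ) - G.adjMatrix ℝ).mulVec x := by
  intro x hx
  have hQ : x ⬝ᵥ ((d : ℝ) • (1 : Matrix (Fin n) (Fin n) ℝ) - G.adjMatrix ℝ).mulVec x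
      = (∑ u, ∑ v, if G.Adj u v then (x u - x v) ^ 2 else 0) / 2 := by
    rw [← SimpleGraph.lapMatrix_toLinearMap₂', Matrix.toLinearMap₂'_apply']
    have : G.lapMatrix ℝ = (d : ℝ) • (1 : Matrix (Fin n) (Fin n) ℝ) - G.adjMatrix ℝ := by
      simp only [SimpleGraph.lapMatrix, SimpleGraph.degMatrix, hreg, Matrix.smul_one_eq_diagonal]
    rw [this]
  rw [hQ]
  refine dirichlet_lower_bound_of_sum_eq_zero G ε hε (fun X hX => ?_) x hx
  convert hmag X (by simpa only [Fintype.card_fin] using hX)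
end

section
/- Let G be a finite group, S a subset of G, ε > 0, and suppose that |AS \ A| ≥ ε|A| for every subset A ⊆ G with |A| ≤ |G|/2, where AS = {as : a ∈ A, s ∈ S}. Let L be a subgroup of G. Then for every collection 𝒜 of right cosets of L in G with |𝒜| ≤ [G:L]/2, writing U for the union of the cosets in 𝒜, the number of right cosets of L that meet the set US but do not belong to 𝒜 is at least ε|𝒜|. In other words, the magnifier property of the Cayley graph of G with respect to S descends to the coset graph on the right cosets of L. -/
open scoped Pointwise

/-- A union of right cosets of `L` has cardinality `|L|` times the number of cosets. -/
theorem card_preimage_mk_rightRel {G : Type*} [Group G] (L : Subgroup G)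
    (T : Set (Quotient (QuotientGroup.rightRel L))) :
    Nat.card {x : G | Quotient.mk (QuotientGroup.rightRel L) x ∈ T} =
      Nat.card L * Nat.card T := by
  have hmk (l : L) (q : Quotient (QuotientGroup.rightRel L)) :
      Quotient.mk (QuotientGroup.rightRel L) (l * q.out) = q := by
    conv_rhs => rw [← q.out_eq]
    refine Quotient.sound (QuotientGroup.rightRel_apply.mpr ?_)
    simp
  rw [← Nat.card_prod]
  symm
  refine Nat.card_congr (Equiv.ofBijective
    (fun p : L × T => ⟨p.1 * p.2.1.out, by simp [hmk]⟩) ⟨?_, ?_⟩)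
  · rintro ⟨l, q⟩ ⟨l', q'⟩ h
    have h : (l : G) * q.1.out = l' * q'.1.out := congrArg Subtype.val h
    have hq : q = q' := Subtype.ext <| by rw [← hmk l q, h, hmk]
    subst hq
    simpa using h
  · rintro ⟨x, hx⟩
    have hl : x * (Quotient.mk (QuotientGroup.rightRel L) x).out⁻¹ ∈ L :=
      QuotientGroup.rightRel_apply.mp (Quotient.mk_out (s := QuotientGroup.rightRel L) x)
    exact ⟨⟨⟨_, hl⟩, ⟨_, hx⟩⟩, by simp⟩

/-- If the Cayley graph of a finite group `G` with respect to `S` is an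
`ε`-magnifier (`|AS \ A| ≥ ε|A|` whenever `|A| ≤ |G|/2`), then for every subgroup `L` the
magnifier property descends to the coset graph on the right cosets of `L`: for every
collection `𝒜` of right cosets of `L` with `|𝒜| ≤ [G:L]/2`, with `U` the union of the
cosets in `𝒜`, the number of right cosets of `L` meeting `US` but not belonging to `𝒜`
is at least `ε|𝒜|`. -/
theorem cayley_magnifier_descends_to_cosets
    {G : Type*} [Group G] [Fintype G]
    (S : Set G) (ε : ℝ) (hε : 0 < ε)
    (hmag : ∀ A : Set G, (Nat.card A : ℝ) ≤ (Fintype.card G : ℝ) / 2 →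
      ε * Nat.card A ≤ (Nat.card ((A * S) \ A : Set G) : ℝ))
    (L : Subgroup G)
    (𝒜 : Set (Quotient (QuotientGroup.rightRel L)))
    (h𝒜 : (Nat.card 𝒜 : ℝ) ≤
      (Nat.card (Quotient (QuotientGroup.rightRel L)) : ℝ) / 2) :
    ε * Nat.card 𝒜 ≤
      (Nat.card {q : Quotient (QuotientGroup.rightRel L) | q ∉ 𝒜 ∧
        ∃ g ∈ ({x : G | Quotient.mk (QuotientGroup.rightRel L) x ∈ 𝒜} * S),
          Quotient.mk (QuotientGroup.rightRel L) g = q} : ℝ) := by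
  have hL : (0 : ℝ) < Nat.card L := by exact_mod_cast Nat.card_pos
  have hG : (Fintype.card G : ℝ) =
      Nat.card L * Nat.card (Quotient (QuotientGroup.rightRel L)) := by
    have h := card_preimage_mk_rightRel L Set.univ
    simp only [Set.mem_univ, Set.ofPred_true, Nat.card_univ] at h
    rw [← Nat.card_eq_fintype_card]
    exact_mod_cast h
  set U : Set G := {x : G | Quotient.mk (QuotientGroup.rightRel L) x ∈ 𝒜}
  set B : Set (Quotient (QuotientGroup.rightRel L)) := {q | q ∉ 𝒜 ∧
    ∃ g ∈ U * S, Quotient.mk (QuotientGroup.rightRel L) g = q}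
  have hcU : (Nat.card U : ℝ) = Nat.card L * Nat.card 𝒜 := by
    exact_mod_cast card_preimage_mk_rightRel L 𝒜
  have hcB : (Nat.card {x : G | Quotient.mk (QuotientGroup.rightRel L) x ∈ B} : ℝ) =
      Nat.card L * Nat.card B := by
    exact_mod_cast card_preimage_mk_rightRel L B
  have hsub : (U * S) \ U ⊆ {x : G | Quotient.mk (QuotientGroup.rightRel L) x ∈ B} :=
    fun x hx => ⟨hx.2, x, hx.1, rfl⟩
  have hle : (Nat.card ((U * S) \ U : Set G) : ℝ) ≤
      Nat.card {x : G | Quotient.mk (QuotientGroup.rightRel L) x ∈ B} := by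
    exact_mod_cast Nat.card_mono (Set.toFinite _) hsub
  have hmagU := hmag U (by rw [hcU, hG, mul_div_assoc]; gcongr)
  rw [hcU] at hmagU
  rw [hcB] at hle
  exact le_of_mul_le_mul_left (by linarith) hL
end
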